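/- Let n ≥ 1, let G be any n-dimensional hypercube-like network (G ∈ HL_n), and let X be any subset of the vertices of G with |X| = g, where 1 ≤ g ≤ 2^n. Write g in binary as g = Σ_{i=0}^s 2^{t_i} with t_0 > t_1 > ... > t_s ≥ 0 and set 2·e_g = Σ_{i=0}^s (t_i + 2i)·2^{t_i}. Then the number of edges of G having exactly one endpoint in X is at least n·g − 2·e_g. -/

import Mathlib

/-- `IsHL n G` : `G` is an `n`-dimensional hypercube-like network (`G ∈ HL_n`).
`HL_0 = {K_1}`, and `G ∈ HL_n` iff the vertex set can be partitioned into `S` and `Sᶜ`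
with both induced subgraphs in `HL_{n-1}` and the edges between `S` and `Sᶜ`
forming a perfect matching between them. -/
def IsHL : (n : ℕ) → {V : Type} → [Fintype V] → [DecidableEq V] → SimpleGraph V → Prop
  | 0, V, _, _, _ => Fintype.card V = 1
  | n + 1, _, _, _, G =>
      ∃ S : Finset _,
        IsHL n (G.induce (S : Set _)) ∧
        IsHL n (G.induce ((Sᶜ : Finset _) : Set _)) ∧
        (∀ v ∈ S, ∃! w, w ∉ S ∧ G.Adj v w) ∧
        (∀ v ∉ S, ∃! w, w ∈ S ∧ G.Adj v w)

/-- The total number of binary ones of all `k < g`, computed by halving; it is the maximal number of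
edges induced by `g` vertices of a hypercube. -/
def cubeEdges (g : ℕ) : ℕ :=
  if g ≤ 1 then 0 else cubeEdges (g / 2) + cubeEdges ((g + 1) / 2) + g / 2
termination_by g
decreasing_by all_goals omega

theorem cubeEdges_zero : cubeEdges 0 = 0 := by
  rw [cubeEdges]; simp

theorem cubeEdges_one : cubeEdges 1 = 0 := by
  rw [cubeEdges]; simp

theorem cubeEdges_two_mul (m : ℕ) : cubeEdges (2 * m) = 2 * cubeEdges m + m := by
  rcases Nat.eq_zero_or_pos m with rfl | hm
  · simp [cubeEdges_zero]
  · rw [cubeEdges, if_neg (by omega), show 2 * m / 2 = m by omega,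
      show (2 * m + 1) / 2 = m by omega]
    ring

theorem cubeEdges_two_mul_add_one (m : ℕ) :
    cubeEdges (2 * m + 1) = cubeEdges m + cubeEdges (m + 1) + m := by
  rcases Nat.eq_zero_or_pos m with rfl | hm
  · simp [cubeEdges_zero, cubeEdges_one]
  · rw [cubeEdges, if_neg (by omega), show (2 * m + 1) / 2 = m by omega,
      show (2 * m + 1 + 1) / 2 = m + 1 by omega]

theorem cubeEdges_add_le (a b : ℕ) :
    cubeEdges a + cubeEdges b + min a b ≤ cubeEdges (a + b) := by
  induction h : a + b using Nat.strong_induction_on generalizing a b with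
  | _ N ih =>
    subst h
    have ih' (c d : ℕ) (hcd : c + d < a + b) :
        cubeEdges c + cubeEdges d + min c d ≤ cubeEdges (c + d) := ih _ hcd c d rfl
    rcases Nat.eq_zero_or_pos a with rfl | ha
    · simp [cubeEdges_zero]
    rcases Nat.eq_zero_or_pos b with rfl | hb
    · simp [cubeEdges_zero]
    obtain ⟨p, hp⟩ := Nat.even_or_odd' a
    obtain ⟨q, hq⟩ := Nat.even_or_odd' b
    rcases hp with rfl | rfl <;> rcases hq with rfl | rfl
    · have h₁ := ih' p q (by omega)
      rw [← mul_add]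
      simp only [cubeEdges_two_mul]
      omega
    · have h₁ := ih' p q (by omega)
      have h₂ := ih' p (q + 1) (by omega)
      rw [← add_assoc] at h₂
      rw [show 2 * p + (2 * q + 1) = 2 * (p + q) + 1 by ring]
      simp only [cubeEdges_two_mul, cubeEdges_two_mul_add_one]
      omega
    · have h₁ := ih' p q (by omega)
      have h₂ := ih' (p + 1) q (by omega)
      rw [add_right_comm p 1 q] at h₂
      rw [show 2 * p + 1 + 2 * q = 2 * (p + q) + 1 by ring]
      simp only [cubeEdges_two_mul, cubeEdges_two_mul_add_one]
      omega
    · have h₁ := ih' p (q + 1) (by omega)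
      have h₂ := ih' (p + 1) q (by omega)
      rw [← add_assoc] at h₁
      rw [add_right_comm p 1 q] at h₂
      rw [show 2 * p + 1 + (2 * q + 1) = 2 * (p + q + 1) by ring]
      simp only [cubeEdges_two_mul, cubeEdges_two_mul_add_one]
      omega

theorem two_mul_cubeEdges_two_pow_add (t r : ℕ) (hr : r ≤ 2 ^ t) :
    2 * cubeEdges (2 ^ t + r) = t * 2 ^ t + 2 * cubeEdges r + 2 * r := by
  induction t generalizing r with
  | zero =>
    have h₂ := cubeEdges_two_mul 1
    rw [pow_zero] at hr
    interval_cases r <;> simp_all [cubeEdges_zero, cubeEdges_one]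
  | succ t ih =>
    rw [pow_succ] at hr
    obtain ⟨p, rfl | rfl⟩ := Nat.even_or_odd' r
    · have h₁ := ih p (by omega)
      rw [show 2 ^ (t + 1) + 2 * p = 2 * (2 ^ t + p) by ring]
      simp only [cubeEdges_two_mul]
      linear_combination 2 * h₁
    · have h₁ := ih p (by omega)
      have h₂ := ih (p + 1) (by omega)
      rw [← add_assoc] at h₂
      rw [show 2 ^ (t + 1) + (2 * p + 1) = 2 * (2 ^ t + p) + 1 by ring]
      simp only [cubeEdges_two_mul_add_one]
      linear_combination h₁ + h₂

theorem sum_two_pow_lt_of_strictAnti {k : ℕ} {t : Fin k → ℕ} (ht : StrictAnti t) {m : ℕ}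
    (hm : ∀ i, t i < m) : ∑ i, 2 ^ t i < 2 ^ m := by
  rw [← Finset.sum_image (g := t) (f := fun j => 2 ^ j) ht.injective.injOn]
  exact Nat.geomSum_lt le_rfl (by simpa using hm)

theorem two_mul_cubeEdges_sum_two_pow {k : ℕ} {t : Fin k → ℕ} (ht : StrictAnti t) :
    2 * cubeEdges (∑ i, 2 ^ t i) = ∑ i : Fin k, (t i + 2 * (i : ℕ)) * 2 ^ t i := by
  induction k with
  | zero => simp [cubeEdges_zero]
  | succ k ih =>
    have ht' : StrictAnti fun i : Fin k => t i.succ :=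
      fun i j hij => ht (Fin.succ_lt_succ_iff.mpr hij)
    have hlt := sum_two_pow_lt_of_strictAnti ht' fun i => ht (Fin.succ_pos i)
    rw [Fin.sum_univ_succ, Fin.sum_univ_succ, two_mul_cubeEdges_two_pow_add _ _ hlt.le, ih ht',
      Fin.val_zero, mul_zero, add_zero, add_assoc, Finset.mul_sum, ← Finset.sum_add_distrib]
    congr 1
    refine Finset.sum_congr rfl fun i _ => ?_
    rw [Fin.val_succ]
    ring

namespace SimpleGraph

variable {V : Type*} (G : SimpleGraph V)

/-- The darts of `G` (as ordered pairs) that leave `X`. -/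
def boundaryDarts (X : Set V) : Set (V × V) := {p | p.1 ∈ X ∧ p.2 ∉ X ∧ G.Adj p.1 p.2}

theorem ncard_boundary_edges_eq (X : Set V) :
    {e : Sym2 V | e ∈ G.edgeSet ∧ ∃ u v : V, e = s(u, v) ∧ u ∈ X ∧ v ∉ X}.ncard =
      (G.boundaryDarts X).ncard := by
  have himage : {e : Sym2 V | e ∈ G.edgeSet ∧ ∃ u v : V, e = s(u, v) ∧ u ∈ X ∧ v ∉ X} =
      (fun p : V × V => s(p.1, p.2)) '' G.boundaryDarts X := by
    ext e
    constructor
    · rintro ⟨he, u, v, rfl, hu, hv⟩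
      exact ⟨(u, v), ⟨hu, hv, he⟩, rfl⟩
    · rintro ⟨⟨u, v⟩, ⟨hu, hv, h⟩, rfl⟩
      exact ⟨h, u, v, rfl, hu, hv⟩
  rw [himage]
  refine Set.InjOn.ncard_image ?_
  rintro ⟨u, v⟩ ⟨hu, hv, -⟩ ⟨u', v'⟩ ⟨hu', hv', -⟩ h
  rcases Sym2.eq_iff.mp h with ⟨rfl, rfl⟩ | ⟨rfl, rfl⟩
  · rfl
  · exact absurd hu hv'

/-- The darts leaving both `X` and `S` number at least `|X ∩ S| - |X \ S|` when the edges between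
`S` and its complement form a perfect matching. -/
theorem ncard_inter_le_ncard_boundaryDarts_add [Finite V] {S : Set V}
    (h : ∀ v ∈ S, ∃! w, w ∉ S ∧ G.Adj v w) (h' : ∀ v ∉ S, ∃! w, w ∈ S ∧ G.Adj v w) (X : Set V) :
    (X ∩ S).ncard ≤ (G.boundaryDarts X ∩ {p | p.1 ∈ S ∧ p.2 ∉ S}).ncard + (X \ S).ncard := by
  choose! m hm using fun v hv => (h v hv).exists
  have hinj : Set.InjOn m S := fun u hu v hv huv =>
    (h' _ (hm u hu).1).unique ⟨hu, (hm u hu).2.symm⟩ ⟨hv, huv ▸ (hm v hv).2.symm⟩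
  have h₁ : ((X ∩ S) \ m ⁻¹' X).ncard ≤
      (G.boundaryDarts X ∩ {p | p.1 ∈ S ∧ p.2 ∉ S}).ncard :=
    Set.ncard_le_ncard_of_injOn (fun u => (u, m u))
      (fun u hu => ⟨⟨hu.1.1, hu.2, (hm u hu.1.2).2⟩, hu.1.2, (hm u hu.1.2).1⟩)
      (fun u _ v _ huv => congrArg Prod.fst huv)
  have h₂ : ((X ∩ S) ∩ m ⁻¹' X).ncard ≤ (X \ S).ncard :=
    Set.ncard_le_ncard_of_injOn m (fun u hu => ⟨hu.2, (hm u hu.1.2).1⟩)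
      (hinj.mono fun u hu => hu.1.2)
  have h₃ := Set.ncard_inter_add_ncard_sdiff_eq_ncard (X ∩ S) (m ⁻¹' X)
  omega

theorem ncard_boundaryDarts_induce [Finite V] (S X : Set V) :
    ((G.induce S).boundaryDarts (Subtype.val ⁻¹' X)).ncard =
      (G.boundaryDarts X ∩ {p | p.1 ∈ S ∧ p.2 ∈ S}).ncard := by
  rw [← Set.ncard_image_of_injective _
    (Subtype.val_injective.prodMap (Subtype.val_injective (p := (· ∈ S))))]
  congr 1
  ext ⟨u, v⟩
  constructor
  · rintro ⟨⟨a, b⟩, ⟨ha, hb, hab⟩, h⟩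
    obtain ⟨rfl, rfl⟩ := Prod.ext_iff.mp h
    exact ⟨⟨ha, hb, hab⟩, a.2, b.2⟩
  · rintro ⟨⟨hu, hv, huv⟩, hu', hv'⟩
    exact ⟨(⟨u, hu'⟩, ⟨v, hv'⟩), ⟨hu, hv, huv⟩, rfl⟩

theorem ncard_boundaryDarts_eq [Finite V] (S X : Set V) :
    (G.boundaryDarts X).ncard =
      (G.boundaryDarts X ∩ {p | p.1 ∈ S ∧ p.2 ∈ S}).ncard +
      (G.boundaryDarts X ∩ {p | p.1 ∈ S ∧ p.2 ∉ S}).ncard +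
      ((G.boundaryDarts X ∩ {p | p.1 ∈ Sᶜ ∧ p.2 ∉ Sᶜ}).ncard +
      (G.boundaryDarts X ∩ {p | p.1 ∈ Sᶜ ∧ p.2 ∈ Sᶜ}).ncard) := by
  rw [← Set.ncard_inter_add_ncard_sdiff_eq_ncard (G.boundaryDarts X) {p | p.1 ∈ S},
    ← Set.ncard_inter_add_ncard_sdiff_eq_ncard (G.boundaryDarts X ∩ {p | p.1 ∈ S}) {p | p.2 ∈ S},
    ← Set.ncard_inter_add_ncard_sdiff_eq_ncard (G.boundaryDarts X \ {p | p.1 ∈ S}) {p | p.2 ∈ S}]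
  congr 3 <;> ext p <;> simp <;> tauto

end SimpleGraph

theorem IsHL.mul_ncard_le {n : ℕ} {V : Type} [Fintype V] [DecidableEq V] {G : SimpleGraph V}
    (hG : IsHL n G) (X : Set V) :
    n * X.ncard ≤ (G.boundaryDarts X).ncard + 2 * cubeEdges X.ncard := by
  induction n generalizing V with
  | zero => simp
  | succ n ih =>
    obtain ⟨S, hS, hS', hm, hm'⟩ := hG
    have h₁ := ih hS (Subtype.val ⁻¹' X)
    have h₂ := ih hS' (Subtype.val ⁻¹' X)
    rw [G.ncard_boundaryDarts_induce, ← Set.ncard_image_of_injective _ Subtype.val_injective,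
      Subtype.image_preimage_coe, Set.inter_comm] at h₁ h₂
    rw [Finset.coe_compl] at h₂
    have h₃ := G.ncard_inter_le_ncard_boundaryDarts_add (S := (S : Set V)) hm hm' X
    have h₄ := G.ncard_inter_le_ncard_boundaryDarts_add (S := (S : Set V)ᶜ)
      (by simpa using hm') (by simpa using hm) X
    have h₅ := G.ncard_boundaryDarts_eq S X
    have h₆ := Set.ncard_inter_add_ncard_sdiff_eq_ncard X (S : Set V)
    rw [Set.sdiff_compl] at h₄
    rw [Set.sdiff_eq] at h₃ h₆
    have h₇ := cubeEdges_add_le (X ∩ S).ncard (X ∩ (S : Set V)ᶜ).ncard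
    rw [h₆] at h₇
    have h₈ : n * X.ncard = n * (X ∩ S).ncard + n * (X ∩ (S : Set V)ᶜ).ncard := by
      rw [← h₆, mul_add]
    rw [add_one_mul, h₈]
    omega

/-- Lemma 2.2: for `G ∈ HL_n` and any vertex subset `X` with `|X| = g`, `1 ≤ g ≤ 2^n`,
with binary expansion `g = ∑_{i=0}^s 2^(t i)` (`t 0 > t 1 > ... > t s ≥ 0`) and
`2 e_g = ∑_{i=0}^s (t i + 2 i) * 2^(t i)`, the number of edges of `G` with exactly one
endpoint in `X` is at least `n * g - 2 e_g`. -/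
theorem boundary_edges_lower_bound_HL
    {n : ℕ} (hn : 1 ≤ n) {V : Type} [Fintype V] [DecidableEq V]
    (G : SimpleGraph V) (hG : IsHL n G)
    (X : Finset V) (g : ℕ) (hX : X.card = g) (hg1 : 1 ≤ g) (hg2 : g ≤ 2 ^ n)
    (s : ℕ) (t : Fin (s + 1) → ℕ) (ht : StrictAnti t)
    (hsum : g = ∑ i, 2 ^ (t i)) :
    (n : ℤ) * g - ∑ i : Fin (s + 1), ((t i : ℤ) + 2 * (i : ℕ)) * 2 ^ (t i) ≤
      ({e : Sym2 V | e ∈ G.edgeSet ∧ ∃ u v : V, e = s(u, v) ∧ u ∈ X ∧ v ∉ X}.ncard : ℤ) := by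
  subst hX
  have h := hG.mul_ncard_le (X : Set V)
  rw [Set.ncard_coe_finset, ← G.ncard_boundary_edges_eq] at h
  have hE := two_mul_cubeEdges_sum_two_pow ht
  rw [← hsum] at hE
  rw [hE] at h
  simp only [Finset.mem_coe] at h
  zify at h
  linarith
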